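/- arXiv:2108.01843 — 2 statements merged into one kernel-verified Lean document; each statement's English description precedes it below -/
import Mathlib

section
/- Let S be a finite nonempty type, let γ ∈ [0,1), let r : S → ℝ, and let P₁, P₂ : S → S → ℝ be row-stochastic matrices (P_i s s' ≥ 0 and Σ_{s'} P_i s s' = 1 for every s). Suppose V₁, V₂ : S → ℝ satisfy the Bellman equations V₁(s) = r(s) + γ Σ_{s'} P₁ s s' · V₁(s') and V₂(s) = r(s) + γ Σ_{s'} P₂ s s' · V₂(s') for all s. Then max_{s} |V₁(s) − V₂(s)| ≤ (γ/(1−γ)) · max_{s} |Σ_{s'} (P₁ s s' − P₂ s s') · V₂(s')|. -/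
/-- A weighted average with nonnegative weights summing to one is bounded by any uniform bound
on the absolute values of the averaged function. -/
theorem abs_sum_mul_le_of_stochastic {ι : Type*} [Fintype ι] {p f : ι → ℝ} {M : ℝ}
    (hp0 : ∀ i, 0 ≤ p i) (hp1 : ∑ i, p i = 1) (hf : ∀ i, |f i| ≤ M) :
    |∑ i, p i * f i| ≤ M :=
  calc |∑ i, p i * f i| ≤ ∑ i, |p i * f i| := Finset.abs_sum_le_sum_abs _ _
    _ ≤ ∑ i, p i * M := Finset.sum_le_sum fun i _ => by
        rw [abs_mul, abs_of_nonneg (hp0 i)]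
        exact mul_le_mul_of_nonneg_left (hf i) (hp0 i)
    _ = M := by rw [← Finset.sum_mul, hp1, one_mul]

/-- Finite-state core of Lemma 2 (MBOM): the sup-norm difference of the value
functions of two transition models is controlled by the one-step model
discrepancy applied to the second value function. -/
theorem stmt_3 (S : Type) [Fintype S] [Nonempty S]
    (γ : ℝ) (hγ0 : 0 ≤ γ) (hγ1 : γ < 1)
    (r : S → ℝ) (P₁ P₂ : S → S → ℝ)
    (hP₁0 : ∀ s s', 0 ≤ P₁ s s') (hP₁1 : ∀ s, ∑ s', P₁ s s' = 1)
    (hP₂0 : ∀ s s', 0 ≤ P₂ s s') (hP₂1 : ∀ s, ∑ s', P₂ s s' = 1)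
    (V₁ V₂ : S → ℝ)
    (hV₁ : ∀ s, V₁ s = r s + γ * ∑ s', P₁ s s' * V₁ s')
    (hV₂ : ∀ s, V₂ s = r s + γ * ∑ s', P₂ s s' * V₂ s') :
    (⨆ s, |V₁ s - V₂ s|) ≤ γ / (1 - γ) * ⨆ s, |∑ s', (P₁ s s' - P₂ s s') * V₂ s'| := by
  set M := ⨆ s, |V₁ s - V₂ s|
  set D := ⨆ s, |∑ s', (P₁ s s' - P₂ s s') * V₂ s'|
  have hM (s : S) : |V₁ s - V₂ s| ≤ M :=
    le_ciSup (f := fun s => |V₁ s - V₂ s|) (Set.finite_range _).bddAbove s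
  have hD (s : S) : |∑ s', (P₁ s s' - P₂ s s') * V₂ s'| ≤ D :=
    le_ciSup (f := fun s => |∑ s', (P₁ s s' - P₂ s s') * V₂ s'|) (Set.finite_range _).bddAbove s
  have havg (s : S) : |∑ s', P₁ s s' * (V₁ s' - V₂ s')| ≤ M :=
    abs_sum_mul_le_of_stochastic (hP₁0 s) (hP₁1 s) hM
  have hstep : M ≤ γ * (M + D) := by
    refine ciSup_le fun s => ?_
    have hdecomp : V₁ s - V₂ s =
        γ * (∑ s', P₁ s s' * (V₁ s' - V₂ s') + ∑ s', (P₁ s s' - P₂ s s') * V₂ s') := by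
      rw [hV₁ s, hV₂ s]
      simp only [mul_sub, sub_mul, Finset.sum_sub_distrib]
      ring
    rw [hdecomp, abs_mul, abs_of_nonneg hγ0]
    exact mul_le_mul_of_nonneg_left
      ((abs_add_le _ _).trans (add_le_add (havg s) (hD s))) hγ0
  rw [div_mul_eq_mul_div, le_div_iff₀ (sub_pos.mpr hγ1)]
  linarith
end

section
/- Let S be a finite nonempty type, let γ ∈ [0,1), let r : S → ℝ, and let P₁, P₂ : S → S → ℝ be row-stochastic matrices (P_i s s' ≥ 0 and Σ_{s'} P_i s s' = 1 for every s). Suppose V₁, V₂ : S → ℝ satisfy V₁(s) = r(s) + γ Σ_{s'} P₁ s s' · V₁(s') and V₂(s) = r(s) + γ Σ_{s'} P₂ s s' · V₂(s') for all s, and let B = max_{s} |V₂(s)|. Then max_{s} |V₁(s) − V₂(s)| ≤ (γ·B/(1−γ)) · max_{s} Σ_{s'} |P₁ s s' − P₂ s s'|. -/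
/-- Hölder's inequality for the pairing of `ℓ¹` and `ℓ^∞` on a finite type. -/
theorem abs_sum_mul_le_sum_abs_mul {ι : Type*} [Fintype ι] (w v : ι → ℝ) {C : ℝ}
    (hv : ∀ i, |v i| ≤ C) : |∑ i, w i * v i| ≤ (∑ i, |w i|) * C := by
  rw [Finset.sum_mul]
  refine (Finset.abs_sum_le_sum_abs _ _).trans (Finset.sum_le_sum fun i _ => ?_)
  rw [abs_mul]
  exact mul_le_mul_of_nonneg_left (hv i) (abs_nonneg _)

/-- Finite-state instantiation of Lemma 2 (MBOM): value difference bounded by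
γB/(1−γ) times the total-variation (ℓ¹) model discrepancy. -/
theorem stmt_4 (S : Type) [Fintype S] [Nonempty S]
    (γ : ℝ) (hγ0 : 0 ≤ γ) (hγ1 : γ < 1)
    (r : S → ℝ) (P₁ P₂ : S → S → ℝ)
    (hP₁0 : ∀ s s', 0 ≤ P₁ s s') (hP₁1 : ∀ s, ∑ s', P₁ s s' = 1)
    (hP₂0 : ∀ s s', 0 ≤ P₂ s s') (hP₂1 : ∀ s, ∑ s', P₂ s s' = 1)
    (V₁ V₂ : S → ℝ)
    (hV₁ : ∀ s, V₁ s = r s + γ * ∑ s', P₁ s s' * V₁ s')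
    (hV₂ : ∀ s, V₂ s = r s + γ * ∑ s', P₂ s s' * V₂ s')
    (B : ℝ) (hB : B = ⨆ s, |V₂ s|) :
    (⨆ s, |V₁ s - V₂ s|) ≤ γ * B / (1 - γ) * ⨆ s, ∑ s', |P₁ s s' - P₂ s s'| := by
  set D := ⨆ s, |V₁ s - V₂ s|
  set T := ⨆ s, ∑ s', |P₁ s s' - P₂ s s'|
  have hD : ∀ s, |V₁ s - V₂ s| ≤ D := le_ciSup (Set.finite_range _).bddAbove
  have hT : ∀ s, ∑ s', |P₁ s s' - P₂ s s'| ≤ T := le_ciSup (Set.finite_range _).bddAbove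
  have hV₂B : ∀ s, |V₂ s| ≤ B := hB ▸ le_ciSup (Set.finite_range _).bddAbove
  have hB0 : 0 ≤ B := hB ▸ Real.iSup_nonneg fun s => abs_nonneg _
  have key : D ≤ γ * (D + T * B) := by
    refine ciSup_le fun s => ?_
    have hsplit : V₁ s - V₂ s = γ * (∑ s', P₁ s s' * (V₁ s' - V₂ s') +
        ∑ s', (P₁ s s' - P₂ s s') * V₂ s') := by
      rw [hV₁ s, hV₂ s]
      simp only [mul_sub, sub_mul, Finset.sum_sub_distrib]
      ring
    have hcontr : |∑ s', P₁ s s' * (V₁ s' - V₂ s')| ≤ D := by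
      simpa [abs_of_nonneg (hP₁0 s _), hP₁1 s] using
        abs_sum_mul_le_sum_abs_mul (P₁ s) (fun s' => V₁ s' - V₂ s') hD
    have hdiscr : |∑ s', (P₁ s s' - P₂ s s') * V₂ s'| ≤ T * B :=
      (abs_sum_mul_le_sum_abs_mul _ V₂ hV₂B).trans (mul_le_mul_of_nonneg_right (hT s) hB0)
    rw [hsplit, abs_mul, abs_of_nonneg hγ0]
    exact mul_le_mul_of_nonneg_left ((abs_add_le _ _).trans (add_le_add hcontr hdiscr)) hγ0
  rw [div_mul_eq_mul_div, le_div_iff₀ (sub_pos.mpr hγ1)]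
  linarith
end
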